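/- arXiv:2106.06741 — 2 statements merged into one kernel-verified Lean document; each statement's English description precedes it below -/
import Mathlib

section
/- Fix x ∈ X, r > 0, and θ' ∈ Θ' with all entries strictly positive. Then the worst-case expectation max{ Σ_{i,j} L(x,i)·θ_{ij} : θ ∈ cl Θ, D_c(θ'‖θ) ≤ r } equals max{ Ψ(x,P) : P ∈ D_r(θ') }, where Ψ(x,P) = Σ_{i=1}^d L(x,i)·(A_d(P)^{-1})_{id} and D_r(θ') = { P ∈ ℝ^{d×d} row-stochastic with strictly positive entries : Σ_{i=1}^d (π_{θ'})_i · D((P_{θ'})_{i·}‖P_{i·}) ≤ r }. -/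
open scoped Classical

noncomputable section

def Theta (d : ℕ) : Set (Matrix (Fin d) (Fin d) ℝ) :=
  {θ | (∀ i j, 0 < θ i j) ∧ (∑ i, ∑ j, θ i j) = 1 ∧ ∀ i, (∑ j, θ i j) = ∑ j, θ j i}

def ThetaP (d : ℕ) : Set (Matrix (Fin d) (Fin d) ℝ) :=
  {θ | (∀ i j, 0 ≤ θ i j) ∧ (∑ i, ∑ j, θ i j) = 1}

/-- Conditional relative entropy, with the conventions `0·log(0/q) = 0` and `p·log(p/0) = ∞`. -/
def condRelEnt {d : ℕ} (θ' θ : Matrix (Fin d) (Fin d) ℝ) : EReal :=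
  ∑ i, ∑ j,
    if θ' i j = 0 then (0 : EReal)
    else if θ i j = 0 then (⊤ : EReal)
    else ((θ' i j * (Real.log (θ' i j / ∑ k, θ' i k) - Real.log (θ i j / ∑ k, θ i k)) : ℝ) : EReal)

/-- Real-valued conditional relative entropy (valid whenever `θ` has positive entries,
so that no `∞` can occur; the convention `0·log(0/q) = 0` is automatic). -/
def condRelEntR {d : ℕ} (θ' θ : Matrix (Fin d) (Fin d) ℝ) : ℝ :=
  ∑ i, ∑ j, θ' i j * (Real.log (θ' i j / ∑ k, θ' i k) - Real.log (θ i j / ∑ k, θ i k))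

/-- Relative entropy of probability vectors, with the conventions
`0·log(0/q) = 0` and `p·log(p/0) = ∞` for `p > 0`. -/
def relEntRow {d : ℕ} (p q : Fin d → ℝ) : EReal :=
  ∑ j, if p j = 0 then (0 : EReal)
       else if q j = 0 then (⊤ : EReal)
       else ((p j * Real.log (p j / q j) : ℝ) : EReal)

/-- Transition matrix associated with a doublet distribution. -/
def transOf {d : ℕ} (θ : Matrix (Fin d) (Fin d) ℝ) : Matrix (Fin d) (Fin d) ℝ :=
  Matrix.of fun i j => θ i j / ∑ k, θ i k

/-- The matrix `A_d(P)` from the paper. -/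
def Amat (d : ℕ) (P : Matrix (Fin d) (Fin d) ℝ) : Matrix (Fin d) (Fin d) ℝ :=
  Matrix.of fun i j => if (i : ℕ) + 1 = d then (1 : ℝ) else if i = j then P i i - 1 else P j i

/-- The reparametrized ambiguity set `D_r(θ')` of strictly positive row-stochastic
matrices satisfying the weighted relative-entropy constraint. -/
def Dball (d : ℕ) (θ' : Matrix (Fin d) (Fin d) ℝ) (r : ℝ) : Set (Matrix (Fin d) (Fin d) ℝ) :=
  {P | (∀ i j, 0 < P i j) ∧ (∀ i, ∑ j, P i j = 1) ∧
      (∑ i, (((∑ j, θ' i j) : ℝ) : EReal) *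
        relEntRow (fun j => transOf θ' i j) (fun j => P i j)) ≤ (r : EReal)}

/-- A finite sum of extended reals none of which is `⊥` is not `⊥`. -/
lemma EReal.sum_ne_bot_of_forall_ne_bot {ι : Type*} (s : Finset ι) (f : ι → EReal)
    (h : ∀ i ∈ s, f i ≠ ⊥) : ∑ i ∈ s, f i ≠ ⊥ := by
  classical
  induction s using Finset.induction_on with
  | empty => simp
  | insert a s ha ih =>
    rw [Finset.sum_insert ha]
    exact EReal.add_ne_bot_iff.mpr ⟨h a (Finset.mem_insert_self a s),
      ih fun i hi => h i (Finset.mem_insert_of_mem hi)⟩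

/-- A finite sum of extended reals none of which is `⊥` is `⊤` as soon as one term is `⊤`. -/
lemma EReal.sum_eq_top_of_eq_top {ι : Type*} (s : Finset ι) (f : ι → EReal)
    (h : ∀ i ∈ s, f i ≠ ⊥) {a : ι} (ha : a ∈ s) (hfa : f a = ⊤) : ∑ i ∈ s, f i = ⊤ := by
  classical
  rw [← Finset.add_sum_erase s f ha, hfa]
  exact EReal.top_add_of_ne_bot
    (EReal.sum_ne_bot_of_forall_ne_bot _ _ fun i hi => h i (Finset.mem_of_mem_erase hi))

lemma EReal.coe_finset_sum {ι : Type*} (s : Finset ι) (f : ι → ℝ) :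
    ((∑ i ∈ s, f i : ℝ) : EReal) = ∑ i ∈ s, (f i : EReal) := by
  classical
  induction s using Finset.induction_on with
  | empty => simp
  | insert a s ha ih => rw [Finset.sum_insert ha, Finset.sum_insert ha, EReal.coe_add, ih]

/-- An invariant vector of a positive stochastic matrix with one positive entry is positive. -/
lemma pos_of_invariant {ι : Type*} [Fintype ι] {P : Matrix ι ι ℝ} (hP : ∀ i j, 0 < P i j)
    (hrow : ∀ i, ∑ j, P i j = 1) {v : ι → ℝ} (hv : ∀ i, ∑ j, v j * P j i = v i)
    {a : ι} (ha : 0 < v a) (i : ι) : 0 < v i := by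
  have hle : ∀ i ∈ Finset.univ, max (v i) 0 ≤ ∑ j, max (v j) 0 * P j i := fun i _ => by
    refine max_le ?_ (Finset.sum_nonneg fun j _ => mul_nonneg (le_max_right _ _) (hP j i).le)
    rw [← hv i]
    exact Finset.sum_le_sum fun j _ => mul_le_mul_of_nonneg_right (le_max_left _ _) (hP j i).le
  have hsum : ∑ i, max (v i) 0 = ∑ i, ∑ j, max (v j) 0 * P j i := by
    rw [Finset.sum_comm]
    exact Finset.sum_congr rfl fun j _ => by rw [← Finset.mul_sum, hrow, mul_one]
  have heq := (Finset.sum_eq_sum_iff_of_le hle).mp hsum i (Finset.mem_univ i)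
  have hpos : 0 < max (v i) 0 := by
    rw [heq]
    refine Finset.sum_pos' (fun j _ => mul_nonneg (le_max_right _ _) (hP j i).le)
      ⟨a, Finset.mem_univ a, mul_pos (lt_max_of_lt_left ha) (hP a i)⟩
  simpa using hpos

/-- An invariant vector of a positive stochastic matrix with zero sum vanishes. -/
lemma eq_zero_of_invariant {ι : Type*} [Fintype ι] {P : Matrix ι ι ℝ} (hP : ∀ i j, 0 < P i j)
    (hrow : ∀ i, ∑ j, P i j = 1) {v : ι → ℝ} (hv : ∀ i, ∑ j, v j * P j i = v i)
    (hsum : ∑ i, v i = 0) : v = 0 := by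
  have hnonpos : ∀ i ∈ Finset.univ, v i ≤ 0 := fun a _ => by
    by_contra! ha
    have : 0 < ∑ i, v i :=
      Finset.sum_pos (fun i _ => pos_of_invariant hP hrow hv ha i) ⟨a, Finset.mem_univ a⟩
    exact this.ne' hsum
  funext i
  exact (Finset.sum_eq_zero_iff_of_nonpos hnonpos).mp hsum i (Finset.mem_univ i)

lemma Amat_mulVec_of_ne {d : ℕ} (P : Matrix (Fin d) (Fin d) ℝ) (v : Fin d → ℝ) {i : Fin d}
    (hi : (i : ℕ) + 1 ≠ d) : (Amat d P).mulVec v i = ∑ j, v j * P j i - v i := by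
  have h : ∀ j, Amat d P i j * v j = v j * P j i - if i = j then v j else 0 := fun j => by
    by_cases hij : i = j
    · subst hij; simp [Amat, hi]; ring
    · simp [Amat, hi, hij]; ring
  simp only [Matrix.mulVec, dotProduct, h, Finset.sum_sub_distrib, Finset.sum_ite_eq,
    Finset.mem_univ, if_true]

lemma Amat_mulVec_of_eq {d : ℕ} (P : Matrix (Fin d) (Fin d) ℝ) (v : Fin d → ℝ) {i : Fin d}
    (hi : (i : ℕ) + 1 = d) : (Amat d P).mulVec v i = ∑ j, v j := by
  simp [Matrix.mulVec, dotProduct, Amat, hi]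

/-- The linear system with matrix `A_d(P)` characterizes invariant vectors with given sum. -/
lemma Amat_mulVec_eq_single_iff {d : ℕ} {P : Matrix (Fin d) (Fin d) ℝ}
    (hrow : ∀ i, ∑ j, P i j = 1) (v : Fin d → ℝ) (c : ℝ) {l : Fin d} (hl : (l : ℕ) + 1 = d) :
    (Amat d P).mulVec v = Pi.single l c ↔
      (∀ i, ∑ j, v j * P j i = v i) ∧ ∑ i, v i = c := by
  have hne : ∀ i : Fin d, i ≠ l → (i : ℕ) + 1 ≠ d := fun i hi h => hi (Fin.ext (by omega))
  constructor
  · intro h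
    have hoff : ∀ i, i ≠ l → ∑ j, v j * P j i = v i := fun i hi => by
      have := congrFun h i
      rw [Amat_mulVec_of_ne P v (hne i hi), Pi.single_eq_of_ne hi] at this
      linarith
    have hlast : ∑ j, v j * P j l = v l := by
      have htot : ∑ i, ∑ j, v j * P j i = ∑ i, v i := by
        rw [Finset.sum_comm]
        exact Finset.sum_congr rfl fun j _ => by rw [← Finset.mul_sum, hrow, mul_one]
      rw [← Finset.add_sum_erase _ _ (Finset.mem_univ l),
        ← Finset.add_sum_erase _ v (Finset.mem_univ l),
        Finset.sum_congr rfl fun i hi => hoff i (Finset.ne_of_mem_erase hi)] at htot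
      exact add_right_cancel htot
    refine ⟨fun i => ?_, ?_⟩
    · by_cases hi : i = l
      · rw [hi, hlast]
      · exact hoff i hi
    · have := congrFun h l
      rwa [Amat_mulVec_of_eq P v hl, Pi.single_eq_same] at this
  · rintro ⟨hinv, hsum⟩
    funext i
    by_cases hi : i = l
    · rw [hi, Amat_mulVec_of_eq P v hl, Pi.single_eq_same, hsum]
    · rw [Amat_mulVec_of_ne P v (hne i hi), Pi.single_eq_of_ne hi, hinv, sub_self]

lemma isUnit_det_Amat {d : ℕ} {P : Matrix (Fin d) (Fin d) ℝ} (hP : ∀ i j, 0 < P i j)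
    (hrow : ∀ i, ∑ j, P i j = 1) {l : Fin d} (hl : (l : ℕ) + 1 = d) :
    IsUnit (Amat d P).det := by
  rw [isUnit_iff_ne_zero]
  intro hdet
  obtain ⟨v, hv, hAv⟩ := Matrix.exists_mulVec_eq_zero_iff.mpr hdet
  rw [← Pi.single_zero l, Amat_mulVec_eq_single_iff hrow v 0 hl] at hAv
  exact hv (eq_zero_of_invariant hP hrow hAv.1 hAv.2)

/-- The last column of `A_d(P)⁻¹` is the stationary distribution of `P`. -/
lemma eq_Amat_inv_iff {d : ℕ} {P : Matrix (Fin d) (Fin d) ℝ} (hP : ∀ i j, 0 < P i j)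
    (hrow : ∀ i, ∑ j, P i j = 1) {l : Fin d} (hl : (l : ℕ) + 1 = d) (v : Fin d → ℝ) :
    (v = fun i => (Amat d P)⁻¹ i l) ↔ (∀ i, ∑ j, v j * P j i = v i) ∧ ∑ i, v i = 1 := by
  have hdet := isUnit_det_Amat hP hrow hl
  have hcol : (fun i => (Amat d P)⁻¹ i l) = (Amat d P)⁻¹.mulVec (Pi.single l 1) := by
    funext i; simp
  rw [← Amat_mulVec_eq_single_iff hrow v 1 hl, hcol]
  constructor
  · rintro rfl
    rw [Matrix.mulVec_mulVec, Matrix.mul_nonsing_inv _ hdet, Matrix.one_mulVec]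
  · intro h
    rw [← h, Matrix.mulVec_mulVec, Matrix.nonsing_inv_mul _ hdet, Matrix.one_mulVec]

/-- The conditional relative entropy is the weighted relative entropy of the transition rows. -/
lemma condRelEnt_eq_sum_relEntRow {d : ℕ} {θ' θ : Matrix (Fin d) (Fin d) ℝ}
    (hθ' : ∀ i j, 0 < θ' i j) (hθ : ∀ i j, 0 < θ i j) :
    condRelEnt θ' θ = ∑ i, (((∑ j, θ' i j) : ℝ) : EReal) *
      relEntRow (fun j => transOf θ' i j) (fun j => transOf θ i j) := by
  have hrow : ∀ {η : Matrix (Fin d) (Fin d) ℝ}, (∀ i j, 0 < η i j) → ∀ i, 0 < ∑ j, η i j :=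
    fun hη i => Finset.sum_pos (fun j _ => hη i j) ⟨i, Finset.mem_univ i⟩
  refine Finset.sum_congr rfl fun i _ => ?_
  have hsum : ∑ j, θ' i j ≠ 0 := (hrow hθ' i).ne'
  have hq' : ∀ j, transOf θ' i j ≠ 0 := fun j => (div_pos (hθ' i j) (hrow hθ' i)).ne'
  have hq : ∀ j, transOf θ i j ≠ 0 := fun j => (div_pos (hθ i j) (hrow hθ i)).ne'
  simp only [relEntRow, hq', hq, (hθ' i _).ne', (hθ i _).ne', if_false]
  rw [← EReal.coe_finset_sum, ← EReal.coe_finset_sum, ← EReal.coe_mul, Finset.mul_sum]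
  congr 1
  refine Finset.sum_congr rfl fun j _ => ?_
  rw [Real.log_div (hq' j) (hq j), ← mul_assoc]
  simp only [transOf, Matrix.of_apply]
  rw [mul_div_cancel₀ _ hsum]

/-- Finite conditional relative entropy from a positive matrix forces nonzero entries. -/
lemma ne_zero_of_condRelEnt_le {d : ℕ} {θ' θ : Matrix (Fin d) (Fin d) ℝ}
    (hθ' : ∀ i j, 0 < θ' i j) {r : ℝ} (h : condRelEnt θ' θ ≤ (r : EReal)) (i j : Fin d) :
    θ i j ≠ 0 := by
  intro hij
  have hterm : ∀ a b, (if θ' a b = 0 then (0 : EReal) else if θ a b = 0 then (⊤ : EReal)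
      else ((θ' a b * (Real.log (θ' a b / ∑ k, θ' a k) -
        Real.log (θ a b / ∑ k, θ a k)) : ℝ) : EReal)) ≠ ⊥ := fun a b => by
    split_ifs
    · simp
    · simp
    · exact EReal.coe_ne_bot _
  have htop : condRelEnt θ' θ = ⊤ := by
    refine EReal.sum_eq_top_of_eq_top _ _
      (fun a _ => EReal.sum_ne_bot_of_forall_ne_bot _ _ fun b _ => hterm a b)
      (Finset.mem_univ i) ?_
    refine EReal.sum_eq_top_of_eq_top _ _ (fun b _ => hterm i b) (Finset.mem_univ j) ?_
    rw [if_neg (hθ' i j).ne', if_pos hij]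
  rw [htop, top_le_iff] at h
  exact EReal.coe_ne_top r h

lemma closure_Theta_subset (d : ℕ) :
    closure (Theta d) ⊆ {θ | (∀ i j, 0 ≤ θ i j) ∧ (∑ i, ∑ j, θ i j) = 1 ∧
      ∀ i, (∑ j, θ i j) = ∑ j, θ j i} := by
  refine closure_minimal (fun θ hθ => ⟨fun i j => (hθ.1 i j).le, hθ.2⟩) ?_
  simp only [Set.ofPred_and, Set.ofPred_forall]
  refine (isClosed_iInter fun i => isClosed_iInter fun j => ?_).inter
    (IsClosed.inter ?_ (isClosed_iInter fun i => ?_))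
  · exact isClosed_le (by fun_prop) (by fun_prop)
  · exact isClosed_eq (by fun_prop) (by fun_prop)
  · exact isClosed_eq (by fun_prop) (by fun_prop)

theorem stmt_8 (d n : ℕ) (hd : 1 ≤ d) (X : Set (Fin n → ℝ))
    (L : (Fin n → ℝ) → Fin d → ℝ) (x : Fin n → ℝ) (hx : x ∈ X)
    (r : ℝ) (hr : 0 < r)
    (θ' : Matrix (Fin d) (Fin d) ℝ) (hθ' : θ' ∈ ThetaP d) (hθ'pos : ∀ i j, 0 < θ' i j) :
    sSup {v : ℝ | ∃ θ ∈ closure (Theta d),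
        condRelEnt θ' θ ≤ (r : EReal) ∧ v = ∑ i, ∑ j, L x i * θ i j} =
      sSup {v : ℝ | ∃ P ∈ Dball d θ' r,
        v = ∑ i, L x i * (Amat d P)⁻¹ i ⟨d - 1, by omega⟩} := by
  have hl : ((⟨d - 1, by omega⟩ : Fin d) : ℕ) + 1 = d := Nat.sub_add_cancel hd
  congr 1
  ext v
  constructor
  · rintro ⟨θ, hθ, hent, rfl⟩
    obtain ⟨hnonneg, hsum, hbal⟩ := closure_Theta_subset d hθ
    have hpos : ∀ i j, 0 < θ i j := fun i j =>
      (hnonneg i j).lt_of_ne' (ne_zero_of_condRelEnt_le hθ'pos hent i j)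
    have hrow : ∀ i, 0 < ∑ j, θ i j :=
      fun i => Finset.sum_pos (fun j _ => hpos i j) ⟨i, Finset.mem_univ i⟩
    have hP : ∀ i j, 0 < transOf θ i j := fun i j => div_pos (hpos i j) (hrow i)
    have hP1 : ∀ i, ∑ j, transOf θ i j = 1 := fun i => by
      simp only [transOf, Matrix.of_apply]
      rw [← Finset.sum_div, div_self (hrow i).ne']
    have hπ := (eq_Amat_inv_iff hP hP1 hl fun i => ∑ j, θ i j).mpr ⟨fun i => by
      rw [hbal i]
      refine Finset.sum_congr rfl fun j _ => ?_
      simp only [transOf, Matrix.of_apply]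
      rw [mul_div_cancel₀ _ (hrow j).ne'], hsum⟩
    refine ⟨transOf θ, ⟨hP, hP1, ?_⟩, ?_⟩
    · rwa [← condRelEnt_eq_sum_relEntRow hθ'pos hpos]
    · refine Finset.sum_congr rfl fun i _ => ?_
      rw [← Finset.mul_sum, ← congrFun hπ i]
  · rintro ⟨P, ⟨hP, hP1, hent⟩, rfl⟩
    set π : Fin d → ℝ := fun i => (Amat d P)⁻¹ i ⟨d - 1, by omega⟩ with hπ
    obtain ⟨hinv, hsum⟩ := (eq_Amat_inv_iff hP hP1 hl π).mp hπ
    obtain ⟨a, -, ha⟩ : ∃ a ∈ Finset.univ, 0 < π a :=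
      Finset.exists_lt_of_sum_lt (by rw [hsum, Finset.sum_const_zero]; exact one_pos)
    have hπpos := pos_of_invariant hP hP1 hinv ha
    set θ : Matrix (Fin d) (Fin d) ℝ := Matrix.of fun i j => π i * P i j with hθ
    have hrow : ∀ i, ∑ j, θ i j = π i := fun i => by
      simp only [hθ, Matrix.of_apply]
      rw [← Finset.mul_sum, hP1, mul_one]
    have hpos : ∀ i j, 0 < θ i j := fun i j => mul_pos (hπpos i) (hP i j)
    have htrans : transOf θ = P := by
      ext i j
      simp only [transOf, Matrix.of_apply, hrow]
      exact mul_div_cancel_left₀ _ (hπpos i).ne'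
    refine ⟨θ, subset_closure ⟨hpos, ?_, fun i => ?_⟩, ?_, ?_⟩
    · simp only [hrow, hsum]
    · rw [hrow i, ← hinv i]
      rfl
    · rwa [condRelEnt_eq_sum_relEntRow hθ'pos hpos, htrans]
    · refine Finset.sum_congr rfl fun i _ => ?_
      rw [← Finset.mul_sum, hrow i]
end
end

section
/- Let x̂_r : Θ' → X be any (measurable) map satisfying x̂_r(θ') ∈ argmin_{x∈X} ĉ_r(x,θ') for all θ' ∈ Θ'. Then for every r > 0 and every θ ∈ Θ, limsup_{T→∞} (1/T)·log ℙ_θ( c(x̂_r(θ̂_T),θ) > ĉ_r(x̂_r(θ̂_T), θ̂_T) ) ≤ −r. -/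
open scoped Classical

noncomputable section

instance matMeasurableSpace (d : ℕ) : MeasurableSpace (Matrix (Fin d) (Fin d) ℝ) :=
  inferInstanceAs (MeasurableSpace (Fin d → Fin d → ℝ))

/-- Empirical doublet distribution of the trajectory `ξ_0, …, ξ_T`. -/
def empDoublet {d : ℕ} (T : ℕ) (ξ : ℕ → Fin d) : Matrix (Fin d) (Fin d) ℝ :=
  Matrix.of fun i j =>
    (1 / (T : ℝ)) * ∑ t ∈ Finset.range T, if ξ t = i ∧ ξ (t + 1) = j then (1 : ℝ) else 0

/-- The trajectory `ξ_0 = ξ0, ξ_1 = w_0, …, ξ_T = w_{T-1}` (junk value `ξ0` beyond `T`). -/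
def seqOf {d : ℕ} (ξ0 : Fin d) {T : ℕ} (w : Fin T → Fin d) : ℕ → Fin d :=
  fun t => if h : 1 ≤ t ∧ t ≤ T then w ⟨t - 1, by omega⟩ else ξ0

/-- Probability of the trajectory `ξ0, w_0, …, w_{T-1}` under the Markov chain with
transition matrix `P` started at `ξ0`. -/
def pathProb {d : ℕ} (P : Matrix (Fin d) (Fin d) ℝ) (ξ0 : Fin d) (T : ℕ)
    (w : Fin T → Fin d) : ℝ :=
  ∏ t ∈ Finset.range T, P (seqOf ξ0 w t) (seqOf ξ0 w (t + 1))

/-- `ℙ_θ(E(θ̂_T))`: probability, under the Markov chain with transition matrix `P` started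
at `ξ0`, that the empirical doublet distribution after `T` steps satisfies `E`. -/
def probEmp {d : ℕ} (P : Matrix (Fin d) (Fin d) ℝ) (ξ0 : Fin d) (T : ℕ)
    (E : Matrix (Fin d) (Fin d) ℝ → Prop) : ℝ :=
  ∑ w : Fin T → Fin d, if E (empDoublet T (seqOf ξ0 w)) then pathProb P ξ0 T w else 0

/-- Logarithm with values in `EReal`, sending `0` (and negative reals) to `−∞`. -/
def elog (x : ℝ) : EReal := if x ≤ 0 then (⊥ : EReal) else ((Real.log x : ℝ) : EReal)

/-- Expected loss `c(x,θ)` for a fixed loss vector `ℓ = L(x,·)`. -/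
def cfun {d : ℕ} (ℓ : Fin d → ℝ) (θ : Matrix (Fin d) (Fin d) ℝ) : ℝ :=
  ∑ i, ∑ j, ℓ i * θ i j

/-- The distributionally robust predictor `ĉ_r(x,θ')` (for the loss vector `ℓ = L(x,·)`):
the maximum of `c(x,·)` over the conditional-relative-entropy ball when it is nonempty,
and the maximum over all of `cl Θ` otherwise. -/
def chat {d : ℕ} (ℓ : Fin d → ℝ) (r : ℝ) (θ' : Matrix (Fin d) (Fin d) ℝ) : ℝ :=
  if {θ | θ ∈ closure (Theta d) ∧ condRelEnt θ' θ ≤ (r : EReal)}.Nonempty then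
    sSup (cfun ℓ '' {θ | θ ∈ closure (Theta d) ∧ condRelEnt θ' θ ≤ (r : EReal)})
  else sSup (cfun ℓ '' closure (Theta d))

lemma condRelEnt_eq_coe {d : ℕ} (m θ : Matrix (Fin d) (Fin d) ℝ) (hθ : ∀ i j, 0 < θ i j) :
    condRelEnt m θ = ((condRelEntR m θ : ℝ) : EReal) := by
  have hsum : ∀ f : Fin d → ℝ, ((∑ i, f i : ℝ) : EReal) = ∑ i, (f i : EReal) := fun f =>
    map_sum (⟨⟨Real.toEReal, EReal.coe_zero⟩, EReal.coe_add⟩ : ℝ →+ EReal) f Finset.univ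
  unfold condRelEnt condRelEntR
  rw [hsum]
  refine Finset.sum_congr rfl fun i _ => ?_
  rw [hsum]
  refine Finset.sum_congr rfl fun j _ => ?_
  by_cases h : m i j = 0
  · simp [h]
  · simp [h, (hθ i j).ne']

lemma bddAbove_cfun_image_closure_Theta {d : ℕ} (ℓ : Fin d → ℝ) :
    BddAbove (cfun ℓ '' closure (Theta d)) := by
  refine ⟨∑ i, |ℓ i|, ?_⟩
  rintro _ ⟨θ, hθ, rfl⟩
  have hcont : Continuous (cfun ℓ) := by
    unfold cfun
    fun_prop
  refine closure_minimal (t := {θ | cfun ℓ θ ≤ ∑ i, |ℓ i|}) ?_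
    (isClosed_le hcont continuous_const) hθ
  rintro η ⟨hpos, hone, -⟩
  simp only [Set.mem_ofPred_eq, cfun]
  refine Finset.sum_le_sum fun i _ => ?_
  have hrow : ∑ j, η i j ≤ 1 := hone ▸ Finset.single_le_sum (f := fun i => ∑ j, η i j)
    (fun i _ => Finset.sum_nonneg fun j _ => (hpos i j).le) (Finset.mem_univ i)
  have hrow0 : 0 ≤ ∑ j, η i j := Finset.sum_nonneg fun j _ => (hpos i j).le
  rw [← Finset.mul_sum]
  calc ℓ i * ∑ j, η i j ≤ |ℓ i| * ∑ j, η i j := by gcongr; exact le_abs_self _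
    _ ≤ |ℓ i| * 1 := by gcongr
    _ = |ℓ i| := mul_one _

/-- Underestimating the cost at `θ` forces `θ` out of the relative entropy ball. -/
lemma lt_condRelEntR_of_chat_lt {d : ℕ} (ℓ : Fin d → ℝ) (r : ℝ)
    (m θ : Matrix (Fin d) (Fin d) ℝ) (hθ : θ ∈ Theta d) (h : chat ℓ r m < cfun ℓ θ) :
    r < condRelEntR m θ := by
  by_contra! hle
  have hmem : θ ∈ {θ | θ ∈ closure (Theta d) ∧ condRelEnt m θ ≤ (r : EReal)} :=
    ⟨subset_closure hθ, by rw [condRelEnt_eq_coe m θ hθ.1]; exact_mod_cast hle⟩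
  rw [chat, if_pos ⟨θ, hmem⟩] at h
  refine h.not_ge (le_csSup ?_ (Set.mem_image_of_mem _ hmem))
  exact (bddAbove_cfun_image_closure_Theta ℓ).mono (Set.image_mono fun _ h => h.1)

lemma transOf_nonneg {d : ℕ} {m : Matrix (Fin d) (Fin d) ℝ} (hm : ∀ i j, 0 ≤ m i j)
    (i j : Fin d) : 0 ≤ transOf m i j :=
  div_nonneg (hm i j) (Finset.sum_nonneg fun k _ => hm i k)

lemma sum_transOf_le_one {d : ℕ} (m : Matrix (Fin d) (Fin d) ℝ) (i : Fin d) :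
    ∑ j, transOf m i j ≤ 1 := by
  simp only [transOf, Matrix.of_apply, ← Finset.sum_div]
  exact div_self_le_one _

lemma pathProb_nonneg {d : ℕ} {P : Matrix (Fin d) (Fin d) ℝ} (hP : ∀ i j, 0 ≤ P i j)
    (ξ0 : Fin d) (T : ℕ) (w : Fin T → Fin d) : 0 ≤ pathProb P ξ0 T w :=
  Finset.prod_nonneg fun _ _ => hP _ _

lemma seqOf_snoc_of_le {d : ℕ} (ξ0 : Fin d) {T : ℕ} (w : Fin T → Fin d) (a : Fin d) {t : ℕ}
    (ht : t ≤ T) : seqOf ξ0 (Fin.snoc w a : Fin (T + 1) → Fin d) t = seqOf ξ0 w t := by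
  unfold seqOf
  by_cases h : 1 ≤ t
  · rw [dif_pos ⟨h, by omega⟩, dif_pos ⟨h, ht⟩]
    exact Fin.snoc_castSucc (α := fun _ => Fin d) a w ⟨t - 1, by omega⟩
  · rw [dif_neg (by omega), dif_neg (by omega)]

lemma seqOf_snoc_last {d : ℕ} (ξ0 : Fin d) {T : ℕ} (w : Fin T → Fin d) (a : Fin d) :
    seqOf ξ0 (Fin.snoc w a : Fin (T + 1) → Fin d) (T + 1) = a := by
  unfold seqOf
  rw [dif_pos ⟨by omega, le_rfl⟩]
  exact Fin.snoc_last (α := fun _ => Fin d) a w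

lemma pathProb_snoc {d : ℕ} (P : Matrix (Fin d) (Fin d) ℝ) (ξ0 : Fin d) {T : ℕ}
    (w : Fin T → Fin d) (a : Fin d) :
    pathProb P ξ0 (T + 1) (Fin.snoc w a) = pathProb P ξ0 T w * P (seqOf ξ0 w T) a := by
  unfold pathProb
  rw [Finset.prod_range_succ, seqOf_snoc_last, seqOf_snoc_of_le ξ0 w a le_rfl]
  congr 1
  refine Finset.prod_congr rfl fun t ht => ?_
  have := Finset.mem_range.1 ht
  rw [seqOf_snoc_of_le ξ0 w a (by omega), seqOf_snoc_of_le ξ0 w a (by omega)]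

/-- Path weights of a substochastic matrix have total mass at most one. -/
lemma sum_pathProb_le_one {d : ℕ} {P : Matrix (Fin d) (Fin d) ℝ} (hP : ∀ i j, 0 ≤ P i j)
    (hrow : ∀ i, ∑ j, P i j ≤ 1) (ξ0 : Fin d) (T : ℕ) : ∑ w, pathProb P ξ0 T w ≤ 1 := by
  induction T with
  | zero => simp [pathProb]
  | succ T ih =>
    rw [← (Fin.snocEquiv fun _ => Fin d).sum_comp, Fintype.sum_prod_type_right]
    refine le_trans (Finset.sum_le_sum fun w _ => ?_) ih
    calc ∑ a, pathProb P ξ0 (T + 1) (Fin.snoc w a)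
        = pathProb P ξ0 T w * ∑ a, P (seqOf ξ0 w T) a := by
          simp only [pathProb_snoc, Finset.mul_sum]
      _ ≤ pathProb P ξ0 T w * 1 := by
          gcongr
          · exact pathProb_nonneg hP _ _ _
          · exact hrow _
      _ = pathProb P ξ0 T w := mul_one _

lemma empDoublet_nonneg {d : ℕ} (T : ℕ) (ξ : ℕ → Fin d) (i j : Fin d) :
    0 ≤ empDoublet T ξ i j := by
  simp only [empDoublet, Matrix.of_apply]
  positivity

lemma empDoublet_pos {d : ℕ} {T : ℕ} (ξ : ℕ → Fin d) {t : ℕ} (ht : t < T) :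
    0 < empDoublet T ξ (ξ t) (ξ (t + 1)) := by
  have hT : (0 : ℝ) < T := by exact_mod_cast (by omega : 0 < T)
  simp only [empDoublet, Matrix.of_apply]
  refine mul_pos (by positivity) (Finset.sum_pos' (fun s _ => by positivity) ?_)
  exact ⟨t, Finset.mem_range.2 ht, by simp⟩

lemma transOf_empDoublet_pos {d : ℕ} {T : ℕ} (ξ : ℕ → Fin d) {t : ℕ} (ht : t < T) :
    0 < transOf (empDoublet T ξ) (ξ t) (ξ (t + 1)) :=
  div_pos (empDoublet_pos ξ ht) (Finset.sum_pos' (fun k _ => empDoublet_nonneg T ξ _ k)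
    ⟨_, Finset.mem_univ _, empDoublet_pos ξ ht⟩)

/-- Additive path functionals depend on the path only through its empirical doublets. -/
lemma sum_range_eq_mul_sum_empDoublet {d : ℕ} {T : ℕ} (hT : 0 < T) (ξ : ℕ → Fin d)
    (g : Fin d → Fin d → ℝ) :
    ∑ t ∈ Finset.range T, g (ξ t) (ξ (t + 1)) = T * ∑ i, ∑ j, empDoublet T ξ i j * g i j := by
  have hT' : (T : ℝ) ≠ 0 := by exact_mod_cast hT.ne'
  have key : ∀ i j, empDoublet T ξ i j * g i j = (T : ℝ)⁻¹ *
      ∑ t ∈ Finset.range T, if ξ t = i ∧ ξ (t + 1) = j then g i j else 0 := by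
    intro i j
    simp only [empDoublet, Matrix.of_apply, one_div, mul_assoc, Finset.sum_mul, ite_mul, one_mul,
      zero_mul]
  simp only [key, ← Finset.mul_sum]
  rw [mul_inv_cancel_left₀ hT']
  simp_rw [Finset.sum_comm (s := Finset.univ) (t := Finset.range T)]
  refine Finset.sum_congr rfl fun t _ => ?_
  simp [ite_and]

/-- Change of measure from `P_θ` to the empirical transition matrix of the path itself. -/
lemma pathProb_eq_exp_mul {d : ℕ} (θ : Matrix (Fin d) (Fin d) ℝ) (hθ : ∀ i j, 0 < θ i j)
    (ξ0 : Fin d) {T : ℕ} (hT : 0 < T) (w : Fin T → Fin d) :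
    pathProb (transOf θ) ξ0 T w =
      Real.exp (-(T * condRelEntR (empDoublet T (seqOf ξ0 w)) θ)) *
        pathProb (transOf (empDoublet T (seqOf ξ0 w))) ξ0 T w := by
  set ξ := seqOf ξ0 w
  have hP : ∀ i j, 0 < transOf θ i j := fun i j =>
    div_pos (hθ i j) (Finset.sum_pos (fun k _ => hθ i k) ⟨j, Finset.mem_univ j⟩)
  have hD : T * condRelEntR (empDoublet T ξ) θ = ∑ t ∈ Finset.range T,
      (Real.log (transOf (empDoublet T ξ) (ξ t) (ξ (t + 1))) -
        Real.log (transOf θ (ξ t) (ξ (t + 1)))) :=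
    (sum_range_eq_mul_sum_empDoublet hT ξ fun i j =>
      Real.log (transOf (empDoublet T ξ) i j) - Real.log (transOf θ i j)).symm
  unfold pathProb
  rw [hD, ← Finset.sum_neg_distrib, Real.exp_sum, ← Finset.prod_mul_distrib]
  refine Finset.prod_congr rfl fun t ht => ?_
  have hQ := transOf_empDoublet_pos ξ (Finset.mem_range.1 ht)
  rw [neg_sub, Real.exp_sub, Real.exp_log (hP _ _), Real.exp_log hQ, div_mul_cancel₀ _ hQ.ne']

/-- The doublet distribution with transition counts `k` over `T` steps. -/
def doubletOfCounts {d T : ℕ} (k : Fin d → Fin d → Fin (T + 1)) : Matrix (Fin d) (Fin d) ℝ :=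
  Matrix.of fun i j => (1 / (T : ℝ)) * ((k i j : ℕ) : ℝ)

lemma exists_doubletOfCounts_eq_empDoublet {d : ℕ} (T : ℕ) (ξ : ℕ → Fin d) :
    ∃ k : Fin d → Fin d → Fin (T + 1), doubletOfCounts k = empDoublet T ξ := by
  refine ⟨fun i j => ⟨((Finset.range T).filter fun t => ξ t = i ∧ ξ (t + 1) = j).card,
    Nat.lt_succ_of_le ((Finset.card_filter_le _ _).trans (Finset.card_range T).le)⟩, ?_⟩
  ext i j
  simp [doubletOfCounts, empDoublet]

/-- Non-asymptotic large deviation bound by the method of types. -/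
lemma probEmp_le {d : ℕ} (θ : Matrix (Fin d) (Fin d) ℝ) (hθ : ∀ i j, 0 < θ i j) (ξ0 : Fin d)
    {T : ℕ} (hT : 0 < T) (r : ℝ) (E : Matrix (Fin d) (Fin d) ℝ → Prop)
    (hE : ∀ m, E m → r < condRelEntR m θ) :
    probEmp (transOf θ) ξ0 T E ≤ Real.exp (-(T * r)) * ((T : ℝ) + 1) ^ (d * d) := by
  have hk : ∀ k : Fin d → Fin d → Fin (T + 1), ∀ i j, 0 ≤ transOf (doubletOfCounts k) i j :=
    fun k => transOf_nonneg fun i j => by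
      simp only [doubletOfCounts, Matrix.of_apply]
      positivity
  have hpath : ∀ w : Fin T → Fin d,
      (if E (empDoublet T (seqOf ξ0 w)) then pathProb (transOf θ) ξ0 T w else 0) ≤
        Real.exp (-(T * r)) * ∑ k : Fin d → Fin d → Fin (T + 1),
          pathProb (transOf (doubletOfCounts k)) ξ0 T w := by
    intro w
    have hnn : ∀ k ∈ (Finset.univ : Finset (Fin d → Fin d → Fin (T + 1))),
        0 ≤ pathProb (transOf (doubletOfCounts k)) ξ0 T w :=
      fun k _ => pathProb_nonneg (hk k) _ _ _
    split_ifs with h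
    · obtain ⟨k, hkw⟩ := exists_doubletOfCounts_eq_empDoublet T (seqOf ξ0 w)
      rw [pathProb_eq_exp_mul θ hθ ξ0 hT w, ← hkw]
      have hr := hE _ h
      rw [← hkw] at hr
      refine mul_le_mul ?_ (Finset.single_le_sum hnn (Finset.mem_univ k))
        (hnn k (Finset.mem_univ k)) (Real.exp_nonneg _)
      gcongr
    · exact mul_nonneg (Real.exp_nonneg _) (Finset.sum_nonneg hnn)
  calc probEmp (transOf θ) ξ0 T E
      ≤ ∑ w : Fin T → Fin d, Real.exp (-(T * r)) * ∑ k : Fin d → Fin d → Fin (T + 1),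
          pathProb (transOf (doubletOfCounts k)) ξ0 T w := Finset.sum_le_sum fun w _ => hpath w
    _ = Real.exp (-(T * r)) * ∑ k : Fin d → Fin d → Fin (T + 1), ∑ w : Fin T → Fin d,
          pathProb (transOf (doubletOfCounts k)) ξ0 T w := by
        rw [← Finset.mul_sum, Finset.sum_comm]
    _ ≤ Real.exp (-(T * r)) * ∑ _k : Fin d → Fin d → Fin (T + 1), 1 := by
        gcongr with k
        exact sum_pathProb_le_one (hk k) (sum_transOf_le_one _) ξ0 T
    _ = Real.exp (-(T * r)) * ((T : ℝ) + 1) ^ (d * d) := by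
        simp [pow_mul]

lemma inv_mul_elog_le {T : ℕ} (hT : 0 < T) {p B : ℝ} (hB : p ≤ Real.exp B) :
    (((T : ℝ)⁻¹ : ℝ) : EReal) * elog p ≤ (((T : ℝ)⁻¹ * B : ℝ) : EReal) := by
  have hT' : (0 : ℝ) < (T : ℝ)⁻¹ := by positivity
  unfold elog
  split_ifs with h
  · rw [EReal.coe_mul_bot_of_pos hT']
    exact bot_le
  · rw [← EReal.coe_mul]
    have := (Real.log_le_iff_le_exp (not_le.1 h)).2 hB
    exact_mod_cast mul_le_mul_of_nonneg_left this hT'.le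

lemma tendsto_inv_mul_log_add_one :
    Filter.Tendsto (fun T : ℕ => (T : ℝ)⁻¹ * Real.log ((T : ℝ) + 1)) Filter.atTop (nhds 0) := by
  have h := (Real.isLittleO_log_id_atTop.tendsto_div_nhds_zero).comp
    (Filter.tendsto_atTop_add_const_right Filter.atTop (1 : ℝ)
      (tendsto_natCast_atTop_atTop (R := ℝ)))
  have h2 : Filter.Tendsto (fun T : ℕ => 1 + (T : ℝ)⁻¹) Filter.atTop (nhds (1 + 0)) :=
    tendsto_const_nhds.add tendsto_inv_atTop_nhds_zero_nat
  refine (by simpa using h.mul h2 : Filter.Tendsto _ _ (nhds (0 : ℝ))).congr' ?_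
  filter_upwards [Filter.eventually_gt_atTop 0] with T hT
  have hT' : (0 : ℝ) < T := by exact_mod_cast hT
  field_simp

theorem stmt_16 (d n : ℕ) (hd : 1 ≤ d) (X : Set (Fin n → ℝ)) (hX : IsCompact X)
    (L : (Fin n → ℝ) → Fin d → ℝ) (hL : ∀ i, ContinuousOn (fun x => L x i) X)
    (r : ℝ) (hr : 0 < r)
    (xhat : Matrix (Fin d) (Fin d) ℝ → (Fin n → ℝ)) (hmeas : Measurable xhat)
    (hxhat : ∀ θ' ∈ ThetaP d, xhat θ' ∈ X ∧ ∀ y ∈ X, chat (L (xhat θ')) r θ' ≤ chat (L y) r θ')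
    (θ : Matrix (Fin d) (Fin d) ℝ) (hθ : θ ∈ Theta d) (ξ0 : Fin d) :
    Filter.limsup
        (fun T : ℕ => (((T : ℝ)⁻¹ : ℝ) : EReal) *
          elog (probEmp (transOf θ) ξ0 T
            (fun m => chat (L (xhat m)) r m < cfun (L (xhat m)) θ)))
        Filter.atTop ≤ -(r : EReal) := by
  have hlim : Filter.Tendsto
      (fun T : ℕ => (T : ℝ)⁻¹ * (-(T * r) + (d * d : ℕ) * Real.log ((T : ℝ) + 1)))
      Filter.atTop (nhds (-r)) := by
    have h := (tendsto_inv_mul_log_add_one.const_mul ((d * d : ℕ) : ℝ)).const_add (-r)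
    rw [mul_zero, add_zero] at h
    refine h.congr' ?_
    filter_upwards [Filter.eventually_gt_atTop 0] with T hT
    have hT' : (T : ℝ) ≠ 0 := by exact_mod_cast hT.ne'
    field_simp
  have hlimE := (continuous_coe_real_ereal.tendsto (-r)).comp hlim
  rw [EReal.coe_neg] at hlimE
  rw [← hlimE.limsup_eq]
  refine Filter.limsup_le_limsup ?_
  filter_upwards [Filter.eventually_gt_atTop 0] with T hT
  refine inv_mul_elog_le hT ((probEmp_le θ hθ.1 ξ0 hT r _ fun m hm =>
    lt_condRelEntR_of_chat_lt _ r m θ hθ hm).trans_eq ?_)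
  rw [Real.exp_add, Real.exp_nat_mul, Real.exp_log (by positivity)]
end
end
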